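/- arXiv:2212.05650 — 13 statements merged into one kernel-verified Lean document; each statement's English description precedes it below -/
import Mathlib

section
/- In the two-player Price & Choose game, the outcome of every subgame-perfect Nash equilibrium is efficient: if (σ1, σ2) is an SPNE, then σ2(σ1) maximizes a ↦ u1(a) + u2(a) over A. -/
open Finset

/-- In the two-player Price & Choose game, the outcome of every
subgame-perfect Nash equilibrium is efficient: if `(σ1, σ2)` is an SPNE, then
`σ2 σ1` maximizes `a ↦ u1 a + u2 a` over `A`. -/
theorem pc_spne_outcome_efficient
    {A : Type*} [Fintype A] [Nonempty A] (u1 u2 : A → ℝ)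
    (σ1 : A → ℝ) (σ2 : (A → ℝ) → A)
    -- σ1 is a budget-balanced price vector (σ1 ∈ P)
    (hσ1P : ∑ a, σ1 a = 0)
    -- (i) for every p ∈ P, σ2 p maximizes a ↦ u2 a − p a over A
    (hσ2opt : ∀ p : A → ℝ, (∑ a, p a = 0) →
      ∀ a : A, u2 a - p a ≤ u2 (σ2 p) - p (σ2 p))
    -- (ii) σ1 maximizes p ↦ u1 (σ2 p) + p (σ2 p) over P
    (hσ1opt : ∀ p : A → ℝ, (∑ a, p a = 0) →
      u1 (σ2 p) + p (σ2 p) ≤ u1 (σ2 σ1) + σ1 (σ2 σ1)) :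
    ∀ a : A, u1 a + u2 a ≤ u1 (σ2 σ1) + u2 (σ2 σ1) := by
  classical
  intro a
  by_contra hlt
  push Not at hlt
  set d : ℝ := u1 a + u2 a - (u1 (σ2 σ1) + u2 (σ2 σ1)) with hd
  have hdpos : 0 < d := by linarith
  have hk : (0 : ℝ) < (Fintype.card A : ℝ) := by exact_mod_cast Fintype.card_pos
  set k : ℝ := (Fintype.card A : ℝ) with hkdef
  set e : ℝ := d / k with he
  have hepos : 0 < e := div_pos hdpos hk
  have hke : k * e = d := by rw [he]; field_simp
  set m : ℝ := (∑ x, u2 x) / k with hm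
  have hkm : k * m = ∑ x, u2 x := by rw [hm]; field_simp
  -- player 2 gets at least the average at σ1
  have hg : m ≤ u2 (σ2 σ1) - σ1 (σ2 σ1) := by
    have h := Finset.sum_le_sum (fun x (_ : x ∈ (Finset.univ : Finset A)) => hσ2opt σ1 hσ1P x)
    rw [Finset.sum_sub_distrib, hσ1P, Finset.sum_const, Finset.card_univ, nsmul_eq_mul,
      ← hkdef, ← hkm, sub_zero] at h
    exact le_of_mul_le_mul_left h hk
  -- a deviation making `a` player 2's unique best choice
  let p : A → ℝ := fun x => u2 x - (m - e) - (if x = a then d else 0)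
  have hp : ∑ x, p x = 0 := by
    simp only [p, Finset.sum_sub_distrib, Finset.sum_const, Finset.card_univ, nsmul_eq_mul,
      Finset.sum_ite_eq', Finset.mem_univ, if_true]
    rw [← hkdef]
    linarith
  have hchoice : σ2 p = a := by
    by_contra hne
    have h := hσ2opt p hp a
    have h1 : p a = u2 a - (m - e) - d := by simp [p]
    have h2 : ∀ b, b ≠ a → p b = u2 b - (m - e) := by
      intro b hb
      simp [p, hb]
    rw [h1, h2 _ hne] at h
    linarith
  have h := hσ1opt p hp
  rw [hchoice] at h
  have hpa : p a = u2 a - (m - e) - d := by simp [p]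
  rw [hpa] at h
  linarith
end

section
/- In the two-player Price & Choose game, every efficient option is the outcome of some subgame-perfect Nash equilibrium: for each efficient a ∈ A there exists an SPNE (σ1, σ2) with σ2(σ1) = a. In particular, an SPNE exists. -/
open Finset

/-- In the two-player Price & Choose game, every efficient option is
the outcome of some subgame-perfect Nash equilibrium (in particular an SPNE exists). -/
theorem pc_efficient_is_spne_outcome
    {A : Type*} [Fintype A] [Nonempty A] (u1 u2 : A → ℝ)
    (a : A) (ha : ∀ a' : A, u1 a' + u2 a' ≤ u1 a + u2 a) :
    ∃ (σ1 : A → ℝ) (σ2 : (A → ℝ) → A),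
      -- σ1 ∈ P
      (∑ x, σ1 x = 0) ∧
      -- (i) for every p ∈ P, σ2 p maximizes a ↦ u2 a − p a over A
      (∀ p : A → ℝ, (∑ x, p x = 0) →
        ∀ a' : A, u2 a' - p a' ≤ u2 (σ2 p) - p (σ2 p)) ∧
      -- (ii) σ1 maximizes p ↦ u1 (σ2 p) + p (σ2 p) over P
      (∀ p : A → ℝ, (∑ x, p x = 0) →
        u1 (σ2 p) + p (σ2 p) ≤ u1 (σ2 σ1) + σ1 (σ2 σ1)) ∧
      -- the outcome is a
      σ2 σ1 = a := by
  obtain ⟨c, hc⟩ : ∃ c : ℝ, c = (∑ x, u2 x) / (Fintype.card A : ℝ) := ⟨_, rfl⟩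
  have hk : (Fintype.card A : ℝ) ≠ 0 := by
    exact_mod_cast Fintype.card_ne_zero
  have hck : (Fintype.card A : ℝ) * c = ∑ x, u2 x := by
    rw [hc]; field_simp
  have hbr : ∀ p : A → ℝ, ∃ b : A,
      (∀ a' : A, u2 a' - p a' ≤ u2 b - p b) ∧ (p = (fun x => u2 x - c) → b = a) := by
    intro p
    by_cases hp : p = (fun x => u2 x - c)
    · refine ⟨a, ?_, fun _ => rfl⟩
      intro a'
      simp [hp]
    · obtain ⟨b, hb⟩ := Finite.exists_max (fun x => u2 x - p x)
      exact ⟨b, hb, fun h => absurd h hp⟩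
  choose m hm hma using hbr
  have hout : m (fun x => u2 x - c) = a := hma _ rfl
  refine ⟨fun x => u2 x - c, m, ?_, fun p _ => hm p, ?_, hout⟩
  · simp [Finset.sum_sub_distrib, hck]
  · intro p hp
    rw [hout]
    have h1 : ∑ x, (u2 x - p x) ≤ ∑ _x : A, (u2 (m p) - p (m p)) :=
      Finset.sum_le_sum fun x _ => hm p x
    rw [Finset.sum_sub_distrib, hp, sub_zero, ← hck, Finset.sum_const, Finset.card_univ,
      nsmul_eq_mul] at h1
    have hpos : (0 : ℝ) < Fintype.card A := by
      exact_mod_cast Fintype.card_pos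
    have h2 : c ≤ u2 (m p) - p (m p) := le_of_mul_le_mul_left h1 hpos
    have h3 := ha (m p)
    linarith
end

section
/- In the two-player Price & Choose game, every subgame-perfect Nash equilibrium (σ1, σ2) has σ1 equal to the indifference price vector: σ1(a) = u2(a) − Avg2 for all a ∈ A, so that a ↦ u2(a) − σ1(a) is constant on A. -/
open Finset

/-- every SPNE `(σ1, σ2)` of the two-player Price & Choose game has `σ1`
equal to the indifference price vector `a ↦ u2 a − Avg2`, so `a ↦ u2 a − σ1 a` is constant. -/
theorem pc_spne_price_is_indifference
    {A : Type*} [Fintype A] [Nonempty A] (u1 u2 : A → ℝ)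
    (σ1 : A → ℝ) (σ2 : (A → ℝ) → A)
    -- σ1 ∈ P
    (hσ1P : ∑ a, σ1 a = 0)
    -- (i) for every p ∈ P, σ2 p maximizes a ↦ u2 a − p a over A
    (hσ2opt : ∀ p : A → ℝ, (∑ a, p a = 0) →
      ∀ a : A, u2 a - p a ≤ u2 (σ2 p) - p (σ2 p))
    -- (ii) σ1 maximizes p ↦ u1 (σ2 p) + p (σ2 p) over P
    (hσ1opt : ∀ p : A → ℝ, (∑ a, p a = 0) →
      u1 (σ2 p) + p (σ2 p) ≤ u1 (σ2 σ1) + σ1 (σ2 σ1)) :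
    (∀ a : A, σ1 a = u2 a - (∑ x, u2 x) / (Fintype.card A : ℝ)) ∧
    (∀ a b : A, u2 a - σ1 a = u2 b - σ1 b) := by
  classical
  obtain ⟨m, hm⟩ : ∃ m : ℝ, m = (∑ x, u2 x) / (Fintype.card A : ℝ) := ⟨_, rfl⟩
  rw [← hm]
  have hk : (0 : ℝ) < (Fintype.card A : ℝ) := by exact_mod_cast Fintype.card_pos
  have hkm : (Fintype.card A : ℝ) * m = ∑ x, u2 x := by
    rw [hm]; field_simp
  obtain ⟨c, hc⟩ : ∃ c, c = σ2 σ1 := ⟨_, rfl⟩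
  have hmax := hσ2opt σ1 hσ1P
  rw [← hc] at hmax hσ1opt
  -- the maximal payoff of player 2 cannot exceed the average
  have hM : u2 c - σ1 c ≤ m := by
    by_contra! hlt
    obtain ⟨e, he⟩ : ∃ e, e = u2 c - σ1 c - m := ⟨_, rfl⟩
    have hepos : 0 < e := by linarith
    obtain ⟨d, hd⟩ : ∃ d, d = e / (Fintype.card A : ℝ) := ⟨_, rfl⟩
    have hdpos : 0 < d := by rw [hd]; positivity
    have hkd : (Fintype.card A : ℝ) * d = e := by rw [hd]; field_simp
    obtain ⟨p, hp⟩ : ∃ p : A → ℝ, ∀ a, p a = u2 a - m + d - (if a = c then e else 0) :=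
      ⟨_, fun _ => rfl⟩
    have hsum : ∑ a, p a = 0 := by
      simp only [hp, Finset.sum_sub_distrib, Finset.sum_add_distrib, Finset.sum_const,
        Finset.card_univ, nsmul_eq_mul, Finset.sum_ite_eq', Finset.mem_univ, if_true]
      linarith
    have hpc : σ2 p = c := by
      by_contra hne
      have h := hσ2opt p hsum c
      rw [hp, hp, if_pos rfl, if_neg hne] at h
      linarith
    have h := hσ1opt p hsum
    rw [hpc, hp, if_pos rfl] at h
    linarith
  have hle : ∀ a ∈ Finset.univ, u2 a - σ1 a ≤ m := fun a _ => (hmax a).trans hM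
  have hsum : ∑ a, (u2 a - σ1 a) = ∑ _a : A, m := by
    simp only [Finset.sum_sub_distrib, Finset.sum_const, Finset.card_univ, nsmul_eq_mul]
    linarith
  have heq : ∀ a, u2 a - σ1 a = m := fun a =>
    (Finset.sum_eq_sum_iff_of_le hle).1 hsum a (Finset.mem_univ a)
  exact ⟨fun a => by linarith [heq a], fun a b => by rw [heq a, heq b]⟩
end

section
/- For every price vector p : A → ℝ with ∑_{a∈A} p(a) = 0 and every option a that maximizes a' ↦ u2(a') − p(a') over A, player 1's payoff is bounded by u1(a) + p(a) ≤ max_{a'∈A} (u1(a') + u2(a')) − Avg2. -/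
open Finset

/-- for every budget-balanced price vector `p` and every option `a`
maximizing player 2's payoff `a' ↦ u2 a' − p a'`, player 1's payoff satisfies
`u1 a + p a ≤ max_{a'} (u1 a' + u2 a') − Avg2`. -/
theorem pc_first_mover_payoff_bound
    {A : Type*} [Fintype A] [Nonempty A] (u1 u2 : A → ℝ)
    (p : A → ℝ) (hp : ∑ a, p a = 0)
    (a : A) (ha : ∀ a' : A, u2 a' - p a' ≤ u2 a - p a) :
    u1 a + p a ≤
      (Finset.univ.sup' Finset.univ_nonempty fun a' => u1 a' + u2 a')
        - (∑ x, u2 x) / (Fintype.card A : ℝ) := by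
  have h1 : u1 a + u2 a ≤ Finset.univ.sup' Finset.univ_nonempty fun a' => u1 a' + u2 a' :=
    Finset.le_sup' (fun a' => u1 a' + u2 a') (Finset.mem_univ a)
  have h2 : ∑ x, (u2 x - p x) ≤ ∑ _x : A, (u2 a - p a) :=
    Finset.sum_le_sum fun x _ => ha x
  rw [Finset.sum_sub_distrib, hp, Finset.sum_const, Finset.card_univ, nsmul_eq_mul, sub_zero] at h2
  have hk : (0 : ℝ) < (Fintype.card A : ℝ) := by exact_mod_cast Fintype.card_pos
  have h3 : (∑ x, u2 x) / (Fintype.card A : ℝ) ≤ u2 a - p a := by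
    rw [div_le_iff₀ hk]
    linarith
  linarith
end

section
/- In the two-player Price & Choose game, every subgame-perfect Nash equilibrium (σ1, σ2) yields the same payoffs: player 2's equilibrium payoff g2(σ1, σ2(σ1)) equals Avg2, and player 1's equilibrium payoff g1(σ1, σ2(σ1)) equals max_{a∈A}(u1(a) + u2(a)) − Avg2. -/
open Finset

/-- every SPNE of the two-player Price & Choose game yields the same
payoffs: player 2 gets `Avg2` and player 1 gets `max_{a}(u1 a + u2 a) − Avg2`. -/
theorem pc_spne_payoffs
    {A : Type*} [Fintype A] [Nonempty A] (u1 u2 : A → ℝ)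
    (σ1 : A → ℝ) (σ2 : (A → ℝ) → A)
    -- σ1 ∈ P
    (hσ1P : ∑ a, σ1 a = 0)
    -- (i) for every p ∈ P, σ2 p maximizes a ↦ u2 a − p a over A
    (hσ2opt : ∀ p : A → ℝ, (∑ a, p a = 0) →
      ∀ a : A, u2 a - p a ≤ u2 (σ2 p) - p (σ2 p))
    -- (ii) σ1 maximizes p ↦ u1 (σ2 p) + p (σ2 p) over P
    (hσ1opt : ∀ p : A → ℝ, (∑ a, p a = 0) →
      u1 (σ2 p) + p (σ2 p) ≤ u1 (σ2 σ1) + σ1 (σ2 σ1)) :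
    u2 (σ2 σ1) - σ1 (σ2 σ1) = (∑ x, u2 x) / (Fintype.card A : ℝ) ∧
    u1 (σ2 σ1) + σ1 (σ2 σ1) =
      (Finset.univ.sup' Finset.univ_nonempty fun a => u1 a + u2 a)
        - (∑ x, u2 x) / (Fintype.card A : ℝ) := by
  classical
  have hk : (0 : ℝ) < (Fintype.card A : ℝ) := by exact_mod_cast Fintype.card_pos
  set k : ℝ := (Fintype.card A : ℝ) with hkdef
  set m : ℝ := (∑ x, u2 x) / k with hm
  have hmk : ∑ x, u2 x = k * m := by rw [hm]; field_simp
  obtain ⟨b, -, hb⟩ := Finset.exists_mem_eq_sup' (Finset.univ_nonempty (α := A))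
    (fun a => u1 a + u2 a)
  have hle : u1 (σ2 σ1) + u2 (σ2 σ1) ≤
      Finset.univ.sup' Finset.univ_nonempty (fun a => u1 a + u2 a) :=
    Finset.le_sup' (fun a => u1 a + u2 a) (Finset.mem_univ (σ2 σ1))
  rw [hb] at hle ⊢
  -- player 2 gets at least the average
  have h2 : m ≤ u2 (σ2 σ1) - σ1 (σ2 σ1) := by
    have h := Finset.sum_le_sum (fun a (_ : a ∈ (Finset.univ : Finset A)) => hσ2opt σ1 hσ1P a)
    rw [Finset.sum_sub_distrib, hσ1P, hmk, Finset.sum_const, Finset.card_univ, nsmul_eq_mul,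
      ← hkdef, sub_zero] at h
    exact le_of_mul_le_mul_left h hk
  -- player 1 gets at least the rest
  have h1 : u1 b + u2 b - m ≤ u1 (σ2 σ1) + σ1 (σ2 σ1) := by
    refine le_of_forall_pos_le_add fun ε hε => ?_
    let p : A → ℝ := fun a => u2 a - m + ε / k - (if a = b then ε else 0)
    have hp : ∑ a, p a = 0 := by
      simp only [p, Finset.sum_sub_distrib, Finset.sum_add_distrib, Finset.sum_const,
        Finset.card_univ, nsmul_eq_mul, ← hkdef, hmk, Finset.sum_ite_eq', Finset.mem_univ, if_true]
      field_simp
      ring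
    have hsb : σ2 p = b := by
      by_contra hne
      have h := hσ2opt p hp b
      have e1 : p b = u2 b - m + ε / k - ε := by simp [p]
      have e2 : p (σ2 p) = u2 (σ2 p) - m + ε / k - 0 := by
        rw [← if_neg (c := σ2 p = b) (t := ε) (e := (0 : ℝ)) hne]
      linarith
    have h := hσ1opt p hp
    rw [hsb] at h
    simp only [p, if_true] at h
    have := div_pos hε hk
    linarith
  constructor <;> linarith
end

section
/- Fix α ∈ ℝ and consider the Price & Choose game in which player 1 must choose a price vector in P_α = {p : A → ℝ : ∑_{a∈A} p(a) = α}. Then every SPNE outcome is efficient, every efficient option is the outcome of some SPNE, and in every SPNE player 2's payoff equals Avg2 − α/k while player 1's payoff equals max_{a∈A}(u1(a) + u2(a)) − Avg2 + α/k. -/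
open Finset

/-- The average of `u2 - p` is at most the best response value. -/
theorem pc_avg_le {A : Type*} [Fintype A] [Nonempty A] (u2 p : A → ℝ) (b : A)
    (h : ∀ a, u2 a - p a ≤ u2 b - p b) :
    (∑ x, u2 x) / (Fintype.card A : ℝ) - (∑ x, p x) / (Fintype.card A : ℝ) ≤ u2 b - p b := by
  have hk : (0 : ℝ) < Fintype.card A := by exact_mod_cast Fintype.card_pos
  rw [← sub_div, div_le_iff₀ hk, ← Finset.sum_sub_distrib]
  have := Finset.sum_le_card_nsmul Finset.univ (fun x => u2 x - p x) _ (fun x _ => h x)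
  rw [nsmul_eq_mul, Finset.card_univ] at this
  linarith

/-- the Price & Choose game where player 1 chooses a price vector in
`P_α = {p : ∑ p a = α}`. Every SPNE outcome is efficient, every efficient option is
an SPNE outcome, and in every SPNE player 2's payoff is `Avg2 − α/k` while player 1's
payoff is `max_a (u1 a + u2 a) − Avg2 + α/k`. -/
theorem pc_alpha_implementation
    {A : Type*} [Fintype A] [Nonempty A] (u1 u2 : A → ℝ) (α : ℝ) :
    -- every SPNE has an efficient outcome and the stated payoffs
    (∀ (σ1 : A → ℝ) (σ2 : (A → ℝ) → A),
      (∑ a, σ1 a = α) →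
      (∀ p : A → ℝ, (∑ a, p a = α) →
        ∀ a : A, u2 a - p a ≤ u2 (σ2 p) - p (σ2 p)) →
      (∀ p : A → ℝ, (∑ a, p a = α) →
        u1 (σ2 p) + p (σ2 p) ≤ u1 (σ2 σ1) + σ1 (σ2 σ1)) →
      ((∀ a : A, u1 a + u2 a ≤ u1 (σ2 σ1) + u2 (σ2 σ1)) ∧
        u2 (σ2 σ1) - σ1 (σ2 σ1) =
          (∑ x, u2 x) / (Fintype.card A : ℝ) - α / (Fintype.card A : ℝ) ∧
        u1 (σ2 σ1) + σ1 (σ2 σ1) =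
          (Finset.univ.sup' Finset.univ_nonempty fun a => u1 a + u2 a)
            - (∑ x, u2 x) / (Fintype.card A : ℝ) + α / (Fintype.card A : ℝ))) ∧
    -- every efficient option is the outcome of some SPNE
    (∀ a : A, (∀ a' : A, u1 a' + u2 a' ≤ u1 a + u2 a) →
      ∃ (σ1 : A → ℝ) (σ2 : (A → ℝ) → A),
        (∑ x, σ1 x = α) ∧
        (∀ p : A → ℝ, (∑ x, p x = α) →
          ∀ a' : A, u2 a' - p a' ≤ u2 (σ2 p) - p (σ2 p)) ∧
        (∀ p : A → ℝ, (∑ x, p x = α) →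
          u1 (σ2 p) + p (σ2 p) ≤ u1 (σ2 σ1) + σ1 (σ2 σ1)) ∧
        σ2 σ1 = a) := by
  have hk : (0 : ℝ) < Fintype.card A := by exact_mod_cast Fintype.card_pos
  obtain ⟨c, hc⟩ : ∃ c : ℝ,
      c = (∑ x, u2 x) / (Fintype.card A : ℝ) - α / (Fintype.card A : ℝ) := ⟨_, rfl⟩
  have hkc : (Fintype.card A : ℝ) * c = (∑ x, u2 x) - α := by
    rw [hc]; field_simp
  constructor
  · intro σ1 σ2 h1 h2 h3
    have hb := pc_avg_le u2 σ1 (σ2 σ1) (h2 σ1 h1)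
    rw [h1, ← hc] at hb
    have key : ∀ a, u1 a + u2 a - c ≤ u1 (σ2 σ1) + σ1 (σ2 σ1) := by
      classical
      intro a
      apply le_of_forall_pos_le_add
      intro δ hδ
      obtain ⟨ε, hε⟩ : ∃ ε : ℝ, ε = δ / (Fintype.card A : ℝ) := ⟨_, rfl⟩
      have hεpos : 0 < ε := by rw [hε]; positivity
      have hkε : (Fintype.card A : ℝ) * ε = δ := by rw [hε]; field_simp
      obtain ⟨p, hp⟩ : ∃ p : A → ℝ,
          p = fun x => u2 x - c + ε - (if x = a then δ else 0) := ⟨_, rfl⟩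
      have hps : ∑ x, p x = α := by
        rw [hp]
        simp only [Finset.sum_sub_distrib, Finset.sum_add_distrib, Finset.sum_const,
          Finset.card_univ, nsmul_eq_mul, Finset.sum_ite_eq', Finset.mem_univ, if_true]
        linarith
      have hpa : p a = u2 a - c + ε - δ := by simp [hp]
      have hσ : σ2 p = a := by
        by_contra hne
        have h := h2 p hps a
        have hpb : p (σ2 p) = u2 (σ2 p) - c + ε := by
          rw [congrFun hp (σ2 p), if_neg hne, sub_zero]
        linarith
      have h := h3 p hps
      rw [hσ] at h
      linarith
    have hkb := key (σ2 σ1)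
    have heff : ∀ a : A, u1 a + u2 a ≤ u1 (σ2 σ1) + u2 (σ2 σ1) := by
      intro a
      have := key a
      linarith
    have hsup : (Finset.univ.sup' Finset.univ_nonempty fun a => u1 a + u2 a)
        = u1 (σ2 σ1) + u2 (σ2 σ1) :=
      le_antisymm (Finset.sup'_le _ _ fun a _ => heff a)
        (Finset.le_sup' (fun a => u1 a + u2 a) (Finset.mem_univ (σ2 σ1)))
    refine ⟨heff, ?_, ?_⟩
    · linarith
    · rw [hsup]; linarith
  · intro a ha
    classical
    have hex : ∀ p : A → ℝ, ∃ b, ∀ x, u2 x - p x ≤ u2 b - p b := fun p =>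
      Finite.exists_max fun x => u2 x - p x
    choose f hf using hex
    obtain ⟨s, hs⟩ : ∃ s : A → ℝ, s = fun x => u2 x - c := ⟨_, rfl⟩
    have hsx : ∀ x, s x = u2 x - c := fun x => congrFun hs x
    have hbest : ∀ p : A → ℝ, ∀ x,
        u2 x - p x ≤ u2 (if p = s then a else f p) - p (if p = s then a else f p) := by
      intro p x
      split_ifs with h
      · rw [h, hsx, hsx]; linarith
      · exact hf p x
    refine ⟨s, fun p => if p = s then a else f p, ?_, fun p _ => hbest p, ?_, by simp⟩
    · simp only [hsx, Finset.sum_sub_distrib, Finset.sum_const, Finset.card_univ, nsmul_eq_mul]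
      linarith
    · intro p hp
      have h := pc_avg_le u2 p _ (hbest p)
      rw [hp, ← hc] at h
      have h' := ha (if p = s then a else f p)
      simp only [if_true, hsx]
      linarith
end

section
/- In the n-player P^{n−1}&C game, the realized option of every subgame-perfect Nash equilibrium maximizes a ↦ ∑_{i=1}^n u_i(a) over A; conversely, every option maximizing ∑_{i=1}^n u_i is the realized option of some subgame-perfect Nash equilibrium. -/
open Finset

/-- Continuation play in the `P^{n-1}&C` game: the full sequence of the `n` posted
price vectors (indexed `0,…,n-1`, where index `j` stands for the paper's `p^{j+2}`),
given that the first `m` of them are fixed by the history `h` and all subsequent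
price-setters follow the strategy `σ`. -/
noncomputable def pcCont {A : Type*} (n : ℕ)
    (σ : (i : Fin n) → (Fin i.val → (A → ℝ)) → (A → ℝ))
    (m : ℕ) (h : Fin m → (A → ℝ)) (i : Fin n) : A → ℝ :=
  if hm : i.val < m then h ⟨i.val, hm⟩
  else σ i (fun j => pcCont n σ m h ⟨j.val, j.isLt.trans i.isLt⟩)
termination_by i.val
decreasing_by exact j.isLt

/-- Payoff of player `i` (0-indexed) in the `n`-player `P^{n-1}&C` game, given the
sequence `q` of the `n-1` posted price vectors (`q j` is the paper's `p^{j+2}`) and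
the chosen option `a`: with `p^1 = p^{n+1} ≡ 0`, it is `u_i(a) − p^i(a) + p^{i+1}(a)`. -/
noncomputable def pcPayoff {A : Type*} (n : ℕ) (u : Fin n → A → ℝ)
    (q : Fin (n - 1) → (A → ℝ)) (a : A) (i : Fin n) : ℝ :=
  u i a
    - (if h : 1 ≤ i.val then q ⟨i.val - 1, by have := i.isLt; omega⟩ a else 0)
    + (if h : i.val < n - 1 then q ⟨i.val, h⟩ a else 0)

/-- Subgame-perfect Nash equilibrium of the `n`-player `P^{n-1}&C` game: the
price-setters `i = 0,…,n-2` choose balanced price vectors, the last player's choice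
is optimal after every history of balanced prices, and after every history of
balanced prices each price-setter's prescribed (balanced) price vector is optimal
among balanced price vectors, given that all subsequent players follow the profile. -/
def pcSPNE {A : Type*} [Fintype A] (n : ℕ) (hn : 2 ≤ n) (u : Fin n → A → ℝ)
    (σ : (i : Fin (n - 1)) → (Fin i.val → (A → ℝ)) → (A → ℝ))
    (τ : (Fin (n - 1) → (A → ℝ)) → A) : Prop :=
  -- strategies select balanced price vectors
  (∀ (i : Fin (n - 1)) (h : Fin i.val → (A → ℝ)),
      (∀ j, ∑ a, h j a = 0) → ∑ a, σ i h a = 0) ∧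
  -- the last player is optimal at every history
  (∀ q : Fin (n - 1) → (A → ℝ), (∀ j, ∑ a, q j a = 0) →
      ∀ a : A,
        pcPayoff n u q a ⟨n - 1, by omega⟩ ≤
          pcPayoff n u q (τ q) ⟨n - 1, by omega⟩) ∧
  -- each price-setter is optimal at every history
  (∀ (i : Fin (n - 1)) (h : Fin i.val → (A → ℝ)), (∀ j, ∑ a, h j a = 0) →
      ∀ p : A → ℝ, (∑ a, p a = 0) →
        pcPayoff n u (pcCont (n - 1) σ (i.val + 1) (Fin.snoc h p))
            (τ (pcCont (n - 1) σ (i.val + 1) (Fin.snoc h p)))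
            ⟨i.val, by have := i.isLt; omega⟩ ≤
        pcPayoff n u (pcCont (n - 1) σ i.val h)
            (τ (pcCont (n - 1) σ i.val h))
            ⟨i.val, by have := i.isLt; omega⟩)

/-- Average of a function on `A`. -/
noncomputable def pcAvg {A : Type*} [Fintype A] (f : A → ℝ) : ℝ :=
  (∑ a, f a) / (Fintype.card A : ℝ)

/-- Tail sums of the utilities. -/
noncomputable def pcS {A : Type*} (n : ℕ) (u : Fin n → A → ℝ) (k : ℕ) (a : A) : ℝ :=
  ∑ j ∈ Finset.univ.filter (fun j : Fin n => k ≤ j.val), u j a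

/-- Prices indexed by naturals, with zero prices at both ends. -/
noncomputable def pcQ {A : Type*} (n : ℕ) (q : Fin (n - 1) → (A → ℝ)) (k : ℕ) (a : A) : ℝ :=
  if h : 1 ≤ k ∧ k - 1 < n - 1 then q ⟨k - 1, h.2⟩ a else 0

lemma pcS_succ {A : Type*} (n : ℕ) (u : Fin n → A → ℝ) (i : Fin n) (a : A) :
    pcS n u i.val a = u i a + pcS n u (i.val + 1) a := by
  unfold pcS
  rw [← Finset.sum_insert (f := fun j => u j a)]
  · congr 1
    ext j
    simp only [Finset.mem_filter, Finset.mem_univ, true_and, Finset.mem_insert, Fin.ext_iff]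
    omega
  · simp

lemma pcS_zero {A : Type*} (n : ℕ) (u : Fin n → A → ℝ) (a : A) :
    pcS n u 0 a = ∑ i, u i a := by
  simp [pcS]

lemma pcS_top {A : Type*} (n : ℕ) (u : Fin n → A → ℝ) (a : A) :
    pcS n u n a = 0 := by
  unfold pcS
  apply Finset.sum_eq_zero
  intro j hj
  have := j.isLt
  simp at hj
  omega

lemma pcQ_zero {A : Type*} (n : ℕ) (q : Fin (n - 1) → (A → ℝ)) (a : A) :
    pcQ n q 0 a = 0 := by simp [pcQ]

lemma pcQ_succ {A : Type*} (n : ℕ) (q : Fin (n - 1) → (A → ℝ)) (i : Fin (n - 1)) (a : A) :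
    pcQ n q (i.val + 1) a = q i a := by
  have := i.isLt
  simp [pcQ]

lemma pcQ_top {A : Type*} (n : ℕ) (q : Fin (n - 1) → (A → ℝ)) (a : A) :
    pcQ n q n a = 0 := by
  unfold pcQ
  rw [dif_neg]
  omega

lemma pcPayoff_eq {A : Type*} (n : ℕ) (u : Fin n → A → ℝ)
    (q : Fin (n - 1) → (A → ℝ)) (a : A) (i : Fin n) :
    pcPayoff n u q a i = u i a - pcQ n q i.val a + pcQ n q (i.val + 1) a := by
  have hi := i.isLt
  unfold pcPayoff pcQ
  congr 1
  · congr 1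
    by_cases h : 1 ≤ i.val
    · rw [dif_pos h, dif_pos ⟨h, by omega⟩]
    · rw [dif_neg h, dif_neg (by tauto)]
  · by_cases h : i.val < n - 1
    · rw [dif_pos h, dif_pos ⟨by omega, by omega⟩]
      rfl
    · rw [dif_neg h, dif_neg (by omega)]

lemma pcPayoff_last {A : Type*} (n : ℕ) (hn : 2 ≤ n) (u : Fin n → A → ℝ)
    (q : Fin (n - 1) → (A → ℝ)) (a : A) (hlt : n - 1 < n) :
    pcPayoff n u q a ⟨n - 1, hlt⟩ = pcS n u (n - 1) a - pcQ n q (n - 1) a := by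
  rw [pcPayoff_eq]
  have h1 := pcS_succ n u ⟨n - 1, hlt⟩ a
  have h2 : n - 1 + 1 = n := by omega
  simp only [h2, pcS_top, pcQ_top] at h1 ⊢
  linarith

lemma pcCont_lt {A : Type*} (n : ℕ)
    (σ : (i : Fin n) → (Fin i.val → (A → ℝ)) → (A → ℝ))
    (m : ℕ) (h : Fin m → (A → ℝ)) (i : Fin n) (hm : i.val < m) :
    pcCont n σ m h i = h ⟨i.val, hm⟩ := by
  rw [pcCont, dif_pos hm]

lemma pcCont_ge {A : Type*} (n : ℕ)
    (σ : (i : Fin n) → (Fin i.val → (A → ℝ)) → (A → ℝ))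
    (m : ℕ) (h : Fin m → (A → ℝ)) (i : Fin n) (hm : ¬ i.val < m) :
    pcCont n σ m h i = σ i (fun j => pcCont n σ m h ⟨j.val, j.isLt.trans i.isLt⟩) := by
  rw [pcCont, dif_neg hm]

lemma pcCont_balanced {A : Type*} [Fintype A] (n : ℕ)
    (σ : (i : Fin n) → (Fin i.val → (A → ℝ)) → (A → ℝ))
    (hσ : ∀ (i : Fin n) (h : Fin i.val → (A → ℝ)),
      (∀ j, ∑ a, h j a = 0) → ∑ a, σ i h a = 0)
    (m : ℕ) (h : Fin m → (A → ℝ)) (hh : ∀ j, ∑ a, h j a = 0) :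
    ∀ (k : ℕ) (hk : k < n), ∑ a, pcCont n σ m h ⟨k, hk⟩ a = 0 := by
  intro k
  induction k using Nat.strong_induction_on with
  | _ k ih =>
    intro hk
    by_cases hm : k < m
    · rw [pcCont_lt n σ m h ⟨k, hk⟩ hm]
      exact hh _
    · rw [pcCont_ge n σ m h ⟨k, hk⟩ hm]
      apply hσ
      intro j
      exact ih j.val j.isLt _

lemma pcCont_snoc {A : Type*} (n : ℕ)
    (σ : (i : Fin n) → (Fin i.val → (A → ℝ)) → (A → ℝ))
    (i : Fin n) (h : Fin i.val → (A → ℝ)) :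
    pcCont n σ (i.val + 1) (Fin.snoc h (σ i h)) = pcCont n σ i.val h := by
  have key : ∀ (k : ℕ) (hk : k < n),
      pcCont n σ (i.val + 1) (Fin.snoc h (σ i h)) ⟨k, hk⟩ = pcCont n σ i.val h ⟨k, hk⟩ := by
    intro k
    induction k using Nat.strong_induction_on with
    | _ k ih =>
      intro hk
      by_cases h1 : k < i.val
      · rw [pcCont_lt _ _ _ _ ⟨k, hk⟩ h1, pcCont_lt _ _ _ _ ⟨k, hk⟩ (Nat.lt_succ_of_lt h1)]
        simp [Fin.snoc, h1]
      · rw [pcCont_ge _ _ _ _ ⟨k, hk⟩ h1]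
        by_cases h2 : k = i.val
        · subst h2
          rw [pcCont_lt _ _ _ _ ⟨i.val, hk⟩ (Nat.lt_succ_self _)]
          simp only [Fin.snoc, lt_irrefl, dite_false, cast_eq]
          congr 1
          funext j
          exact (pcCont_lt n σ i.val h ⟨j.val, j.isLt.trans hk⟩ j.isLt).symm
        · rw [pcCont_ge _ _ _ _ ⟨k, hk⟩ (by simp only; omega)]
          congr 1
          funext j
          exact ih j.val j.isLt _
  funext k
  exact key k.val k.isLt

lemma pcCont_snoc_self {A : Type*} (n : ℕ)
    (σ : (i : Fin n) → (Fin i.val → (A → ℝ)) → (A → ℝ))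
    (i : Fin n) (h : Fin i.val → (A → ℝ)) (p : A → ℝ) :
    pcCont n σ (i.val + 1) (Fin.snoc h p) i = p := by
  rw [pcCont_lt _ _ _ _ i (Nat.lt_succ_self _)]
  simp [Fin.snoc]

lemma pcQ_snoc {A : Type*} (n : ℕ)
    (σ : (i : Fin (n - 1)) → (Fin i.val → (A → ℝ)) → (A → ℝ))
    (i : Fin (n - 1)) (h : Fin i.val → (A → ℝ)) (p : A → ℝ) (a : A) :
    pcQ n (pcCont (n - 1) σ (i.val + 1) (Fin.snoc h p)) i.val a
      = pcQ n (pcCont (n - 1) σ i.val h) i.val a := by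
  have hi := i.isLt
  unfold pcQ
  by_cases h1 : 1 ≤ i.val ∧ i.val - 1 < n - 1
  · rw [dif_pos h1, dif_pos h1]
    have h2 : i.val - 1 < i.val := by omega
    rw [pcCont_lt _ _ _ _ ⟨i.val - 1, _⟩ h2, pcCont_lt _ _ _ _ ⟨i.val - 1, _⟩ (Nat.lt_succ_of_lt h2)]
    simp [Fin.snoc, h2]
  · rw [dif_neg h1, dif_neg h1]

lemma snoc_balanced {A : Type*} [Fintype A] (m : ℕ) (h : Fin m → (A → ℝ)) (p : A → ℝ)
    (hh : ∀ j, ∑ a, h j a = 0) (hp : ∑ a, p a = 0) :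
    ∀ j, ∑ a, (Fin.snoc h p : Fin (m + 1) → (A → ℝ)) j a = 0 := by
  intro j
  refine Fin.lastCases ?_ (fun j => ?_) j
  · simpa using hp
  · simpa using hh j

lemma pcAvg_le {A : Type*} [Fintype A] [Nonempty A] (T p : A → ℝ) (hp : ∑ a, p a = 0) (a : A)
    (ha : ∀ b, T b - p b ≤ T a - p a) : pcAvg T ≤ T a - p a := by
  have hN : (0 : ℝ) < Fintype.card A := by exact_mod_cast Fintype.card_pos
  unfold pcAvg
  rw [div_le_iff₀ hN]
  calc ∑ b, T b = ∑ b, (T b - p b) := by rw [Finset.sum_sub_distrib, hp, sub_zero]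
    _ ≤ ∑ _b : A, (T a - p a) := Finset.sum_le_sum (fun b _ => ha b)
    _ = _ := by simp only [Finset.sum_const, Finset.card_univ, nsmul_eq_mul, mul_comm]

lemma pcAvg_sum {A : Type*} [Fintype A] [Nonempty A] (T : A → ℝ) :
    ∑ a, (T a - pcAvg T) = 0 := by
  have hN : (Fintype.card A : ℝ) ≠ 0 := by exact_mod_cast Fintype.card_ne_zero
  simp only [Finset.sum_sub_distrib, Finset.sum_const, Finset.card_univ, nsmul_eq_mul, pcAvg]
  field_simp
  ring

lemma pc_forward {A : Type*} [Fintype A] [Nonempty A] (n : ℕ) (hn : 2 ≤ n)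
    (u : Fin n → A → ℝ)
    (σ : (i : Fin (n - 1)) → (Fin i.val → (A → ℝ)) → (A → ℝ))
    (τ : (Fin (n - 1) → (A → ℝ)) → A) (hS : pcSPNE n hn u σ τ) :
    ∀ (d i : ℕ), i + d = n - 1 → ∀ h : Fin i → (A → ℝ), (∀ j, ∑ a, h j a = 0) →
      ∀ b, pcS n u i b - pcQ n (pcCont (n - 1) σ i h) i b ≤
        pcS n u i (τ (pcCont (n - 1) σ i h))
          - pcQ n (pcCont (n - 1) σ i h) i (τ (pcCont (n - 1) σ i h)) := by
  classical
  obtain ⟨hσ, hlast, hopt⟩ := hS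
  intro d
  induction d with
  | zero =>
    intro i hi h hh b
    obtain rfl : i = n - 1 := by omega
    have := hlast (pcCont (n - 1) σ (n - 1) h)
      (fun j => pcCont_balanced _ σ hσ _ h hh j.val j.isLt) b
    rwa [pcPayoff_last n hn, pcPayoff_last n hn] at this
  | succ d ih =>
    intro i0 hi0 h hh b
    obtain ⟨i, rfl⟩ : ∃ i : Fin (n - 1), i.val = i0 := ⟨⟨i0, by omega⟩, rfl⟩
    have hlt : i.val < n := by omega
    set q := pcCont (n - 1) σ i.val h with hq
    have hbal := hσ i h hh
    -- on path
    have h1 := ih (i.val + 1) (by omega) (Fin.snoc h (σ i h)) (snoc_balanced _ h _ hh hbal)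
    rw [pcCont_snoc, ← hq] at h1
    have hqi : ∑ a, pcQ n q (i.val + 1) a = 0 := by
      simp only [pcQ_succ]
      exact pcCont_balanced _ σ hσ _ h hh i.val i.isLt
    have h2 := pcAvg_le (pcS n u (i.val + 1)) (pcQ n q (i.val + 1)) hqi (τ q) h1
    apply le_of_forall_pos_le_add
    intro ε hε
    set T := pcS n u (i.val + 1) with hT
    set e : A → ℝ := fun a => if a = b then ε else 0 with he
    set p : A → ℝ := fun a => (T a - pcAvg T) - (e a - pcAvg e) with hp
    have hpb : ∑ a, p a = 0 := by
      rw [hp, Finset.sum_sub_distrib, pcAvg_sum, pcAvg_sum, sub_zero]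
    have h3 := ih (i.val + 1) (by omega) (Fin.snoc h p) (snoc_balanced _ h _ hh hpb)
    have h4 := hopt i h hh p hpb
    rw [← hq] at h4
    set q' := pcCont (n - 1) σ (i.val + 1) (Fin.snoc h p) with hq'
    have hQ' : ∀ a, pcQ n q' (i.val + 1) a = p a := by
      intro a
      rw [pcQ_succ, hq', pcCont_snoc_self]
    have hb : τ q' = b := by
      by_contra hne
      have := h3 b
      rw [hQ', hQ'] at this
      simp only [hp, he, if_neg hne, if_true] at this
      linarith
    rw [pcPayoff_eq, pcPayoff_eq, hb] at h4
    simp only [hQ'] at h4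
    rw [show pcQ n q' i.val b = pcQ n q i.val b from pcQ_snoc n σ i h p b] at h4
    have h5 := pcS_succ n u ⟨i.val, hlt⟩ b
    have h6 := pcS_succ n u ⟨i.val, hlt⟩ (τ q)
    simp only [← hT] at h5 h6
    have h7 : 0 ≤ pcAvg e := by
      unfold pcAvg
      refine div_nonneg (Finset.sum_nonneg fun a _ => ?_) (Nat.cast_nonneg _)
      simp only [he]
      split_ifs <;> linarith
    have h8 : p b = T b - pcAvg T - (ε - pcAvg e) := by simp [hp, he]
    linarith

/-- Prices from index `k` on are the canonical ones. -/
def pcCanon {A : Type*} [Fintype A] (n : ℕ) (u : Fin n → A → ℝ)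
    (q : Fin (n - 1) → (A → ℝ)) (k : ℕ) : Prop :=
  ∀ j : Fin (n - 1), k ≤ j.val →
    q j = fun a => pcS n u (j.val + 1) a - pcAvg (pcS n u (j.val + 1))

lemma pc_choice {A : Type*} [Fintype A] [Nonempty A] (n : ℕ)
    (u : Fin n → A → ℝ) (astar : A) (hastar : ∀ a : A, ∑ i, u i a ≤ ∑ i, u i astar)
    (q : Fin (n - 1) → (A → ℝ)) :
    ∃ a : A, (pcCanon n u q 0 → a = astar) ∧
      ∀ k, k ≤ n - 1 → pcCanon n u q k →
        ∀ b, pcS n u k b - pcQ n q k b ≤ pcS n u k a - pcQ n q k a := by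
  classical
  have hex : ∃ k, pcCanon n u q k := ⟨n - 1, fun j hj => absurd j.isLt (by omega)⟩
  obtain ⟨a, ha⟩ : ∃ a, ∀ b, pcS n u (Nat.find hex) b - pcQ n q (Nat.find hex) b
      ≤ pcS n u (Nat.find hex) a - pcQ n q (Nat.find hex) a := Finite.exists_max _
  have main : ∀ a, (∀ b, pcS n u (Nat.find hex) b - pcQ n q (Nat.find hex) b
      ≤ pcS n u (Nat.find hex) a - pcQ n q (Nat.find hex) a) →
      ∀ k, k ≤ n - 1 → pcCanon n u q k →
        ∀ b, pcS n u k b - pcQ n q k b ≤ pcS n u k a - pcQ n q k a := by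
    intro a ha k hk hc b
    rcases (Nat.find_min' hex hc).eq_or_lt with h | h
    · rw [← h]; exact ha b
    · obtain ⟨j, rfl⟩ : ∃ j, k = j + 1 := ⟨k - 1, by omega⟩
      have hj := Nat.find_spec hex ⟨j, by omega⟩ (by simp only; omega)
      have e1 : ∀ c, pcQ n q (j + 1) c = pcS n u (j + 1) c - pcAvg (pcS n u (j + 1)) := by
        intro c
        have := pcQ_succ n q ⟨j, by omega⟩ c
        rw [hj] at this
        exact this
      rw [e1, e1]
      linarith
  by_cases h0 : pcCanon n u q 0
  · have hf : Nat.find hex = 0 := by simpa using h0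
    refine ⟨astar, fun _ => rfl, main astar ?_⟩
    intro b
    rw [hf]
    simpa [pcQ_zero, pcS_zero] using hastar b
  · exact ⟨a, fun h => absurd h h0, main a ha⟩

lemma pc_backward {A : Type*} [Fintype A] [Nonempty A] (n : ℕ) (hn : 2 ≤ n)
    (u : Fin n → A → ℝ) (astar : A) (hastar : ∀ a : A, ∑ i, u i a ≤ ∑ i, u i astar) :
    ∃ (σ : (i : Fin (n - 1)) → (Fin i.val → (A → ℝ)) → (A → ℝ))
      (τ : (Fin (n - 1) → (A → ℝ)) → A),
      pcSPNE n hn u σ τ ∧ τ (pcCont (n - 1) σ 0 Fin.elim0) = astar := by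
  choose τ hτ0 hτ using pc_choice n u astar hastar
  set σ : (i : Fin (n - 1)) → (Fin i.val → (A → ℝ)) → (A → ℝ) :=
    fun i _ a => pcS n u (i.val + 1) a - pcAvg (pcS n u (i.val + 1)) with hσ
  have hcan : ∀ m (h : Fin m → (A → ℝ)), pcCanon n u (pcCont (n - 1) σ m h) m := by
    intro m h j hj
    rw [pcCont_ge _ _ _ _ j (by omega)]
  refine ⟨σ, τ, ⟨?_, ?_, ?_⟩, hτ0 _ (hcan 0 _)⟩
  · intro i h _
    exact pcAvg_sum _
  · intro q _ a
    rw [pcPayoff_last n hn, pcPayoff_last n hn]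
    exact hτ q (n - 1) le_rfl (fun j hj => absurd j.isLt (by omega)) a
  · intro i h hh p hp
    have hi := i.isLt
    have hlt : i.val < n := by omega
    set q := pcCont (n - 1) σ i.val h with hq
    set q' := pcCont (n - 1) σ (i.val + 1) (Fin.snoc h p) with hq'
    have hQ' : ∀ a, pcQ n q' (i.val + 1) a = p a := by
      intro a
      rw [pcQ_succ, hq', pcCont_snoc_self]
    have h1 := hτ q i.val hi.le (hcan _ _) (τ q')
    have h2 := hτ q' (i.val + 1) (by omega) (hcan _ _)
    simp only [hQ'] at h2
    have h3 := pcAvg_le _ p hp _ h2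
    have h4 : pcQ n q (i.val + 1) (τ q)
        = pcS n u (i.val + 1) (τ q) - pcAvg (pcS n u (i.val + 1)) := by
      rw [pcQ_succ]
      exact congrFun (hcan i.val h i le_rfl) _
    rw [pcPayoff_eq, pcPayoff_eq]
    simp only [hQ', h4]
    rw [show pcQ n q' i.val (τ q') = pcQ n q i.val (τ q') from pcQ_snoc n σ i h p _]
    have h5 := pcS_succ n u ⟨i.val, hlt⟩ (τ q')
    have h6 := pcS_succ n u ⟨i.val, hlt⟩ (τ q)
    simp only at h5 h6
    linarith

/-- the realized option of every SPNE of the `n`-player `P^{n-1}&C` game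
maximizes `a ↦ ∑ i, u_i a`, and conversely every maximizer of `∑ i, u_i` is the
realized option of some SPNE. -/
theorem pc_nplayer_implementation
    {A : Type*} [Fintype A] [Nonempty A] (n : ℕ) (hn : 2 ≤ n)
    (u : Fin n → A → ℝ) :
    (∀ (σ : (i : Fin (n - 1)) → (Fin i.val → (A → ℝ)) → (A → ℝ))
        (τ : (Fin (n - 1) → (A → ℝ)) → A),
      pcSPNE n hn u σ τ →
      ∀ a : A, ∑ i, u i a ≤ ∑ i, u i (τ (pcCont (n - 1) σ 0 Fin.elim0))) ∧
    (∀ astar : A, (∀ a : A, ∑ i, u i a ≤ ∑ i, u i astar) →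
      ∃ (σ : (i : Fin (n - 1)) → (Fin i.val → (A → ℝ)) → (A → ℝ))
        (τ : (Fin (n - 1) → (A → ℝ)) → A),
        pcSPNE n hn u σ τ ∧ τ (pcCont (n - 1) σ 0 Fin.elim0) = astar) := by
  refine ⟨?_, pc_backward n hn u⟩
  intro σ τ hS a
  have := pc_forward n hn u σ τ hS (n - 1) 0 (by omega) Fin.elim0 (fun j => j.elim0) a
  simpa [pcQ_zero, pcS_zero] using this
end

section
/- Let η : ℝ → ℝ be continuous, strictly increasing and surjective. Then there exists a unique price vector p : A → ℝ with ∑_{a∈A} p(a) = 0 such that the map a ↦ u2(a) − η(p(a)) is constant on A. -/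
open Finset

/-- for `η : ℝ → ℝ` continuous, strictly increasing and surjective,
there is a unique budget-balanced price vector `p` making `a ↦ u2 a − η (p a)`
constant on `A`. -/
theorem pc_nonQL_indifference_price_unique
    {A : Type*} [Fintype A] [Nonempty A] (u2 : A → ℝ)
    (η : ℝ → ℝ) (hc : Continuous η) (hm : StrictMono η)
    (hs : Function.Surjective η) :
    ∃! p : A → ℝ, (∑ a, p a = 0) ∧
      ∀ a b : A, u2 a - η (p a) = u2 b - η (p b) := by
  let e := StrictMono.orderIsoOfSurjective η hm hs
  have he : ∀ x, η (e.symm x) = x := fun x => e.apply_symm_apply x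
  have hcont : Continuous (fun c : ℝ => ∑ a, e.symm (u2 a - c)) := by
    refine continuous_finset_sum _ (fun a _ => ?_)
    exact e.symm.continuous.comp (continuous_const.sub continuous_id)
  obtain ⟨aM, hM⟩ := Finite.exists_max u2
  obtain ⟨am, hm'⟩ := Finite.exists_min u2
  have h1 : ∑ a, e.symm (u2 a - (u2 aM - η 0)) ≤ 0 := by
    refine Finset.sum_nonpos (fun a _ => ?_)
    rw [← hm.le_iff_le, he]
    linarith [hM a]
  have h2 : 0 ≤ ∑ a, e.symm (u2 a - (u2 am - η 0)) := by
    refine Finset.sum_nonneg (fun a _ => ?_)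
    rw [← hm.le_iff_le, he]
    linarith [hm' a]
  obtain ⟨c, hc0⟩ := mem_range_of_exists_le_of_exists_ge hcont ⟨_, h1⟩ ⟨_, h2⟩
  have key : ∀ p q : A → ℝ, (∑ a, p a = 0) → (∑ a, q a = 0) →
      (∀ a b : A, u2 a - η (p a) = u2 b - η (p b)) →
      (∀ a b : A, u2 a - η (q a) = u2 b - η (q b)) →
      p aM ≤ q aM → p = q := by
    intro p q hp hq hp' hq' hle
    have hall : ∀ a ∈ Finset.univ, p a ≤ q a := by
      intro a _
      rw [← hm.le_iff_le]
      linarith [hp' a aM, hq' a aM, hm.monotone hle]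
    have := (Finset.sum_eq_sum_iff_of_le hall).1 (hp.trans hq.symm)
    exact funext fun a => this a (Finset.mem_univ a)
  refine ⟨fun a => e.symm (u2 a - c), ⟨hc0, fun a b => ?_⟩, ?_⟩
  · simp only [he]
    ring
  · rintro q ⟨hq, hq'⟩
    have hp' : ∀ a b : A, u2 a - η (e.symm (u2 a - c)) = u2 b - η (e.symm (u2 b - c)) := by
      intro a b
      simp only [he]
      ring
    rcases le_total (q aM) (e.symm (u2 aM - c)) with h | h
    · exact key q (fun a => e.symm (u2 a - c)) hq hc0 hq' hp' h
    · exact (key (fun a => e.symm (u2 a - c)) q hc0 hq hp' hq' h).symm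
end

section
/- Let β : ℝ → ℝ be strictly increasing and consider the Price & Choose game with non-quasi-linear payoffs h1(p,a) = u1(a) + β(p(a)) and h2(p,a) = u2(a) − p(a). In every subgame-perfect Nash equilibrium (σ1, σ2), the price vector satisfies σ1(a) = u2(a) − Avg2 for all a ∈ A. -/
open Finset

/-- in the Price & Choose game with non-quasi-linear payoffs
`h1(p,a) = u1 a + β (p a)` and `h2(p,a) = u2 a − p a`, where `β` is strictly
increasing, every SPNE `(σ1, σ2)` has `σ1 a = u2 a − Avg2` for all `a`. -/
theorem pc_nonQL_spne_price
    {A : Type*} [Fintype A] [Nonempty A] (u1 u2 : A → ℝ)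
    (β : ℝ → ℝ) (hβ : StrictMono β)
    (σ1 : A → ℝ) (σ2 : (A → ℝ) → A)
    -- σ1 ∈ P
    (hσ1P : ∑ a, σ1 a = 0)
    -- (i) for every p ∈ P, σ2 p maximizes a ↦ u2 a − p a over A
    (hσ2opt : ∀ p : A → ℝ, (∑ a, p a = 0) →
      ∀ a : A, u2 a - p a ≤ u2 (σ2 p) - p (σ2 p))
    -- (ii) σ1 maximizes p ↦ u1 (σ2 p) + β (p (σ2 p)) over P
    (hσ1opt : ∀ p : A → ℝ, (∑ a, p a = 0) →
      u1 (σ2 p) + β (p (σ2 p)) ≤ u1 (σ2 σ1) + β (σ1 (σ2 σ1))) :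
    ∀ a : A, σ1 a = u2 a - (∑ x, u2 x) / (Fintype.card A : ℝ) := by
  classical
  set b := σ2 σ1 with hb
  set k : ℝ := (Fintype.card A : ℝ) with hk
  have hkpos : 0 < k := by
    rw [hk]; exact_mod_cast Fintype.card_pos
  set v : ℝ := (∑ x, u2 x) / k with hv
  have hvk : k * v = ∑ x, u2 x := by rw [hv]; field_simp
  have hmax : ∀ a, u2 a - σ1 a ≤ u2 b - σ1 b := hσ2opt σ1 hσ1P
  have hle : u2 b - σ1 b ≤ v := by
    by_contra! hlt
    set e : ℝ := (u2 b - σ1 b - v) / k with he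
    have hepos : 0 < e := div_pos (by linarith) hkpos
    have hek : k * e = u2 b - σ1 b - v := by rw [he]; field_simp
    set p : A → ℝ := fun a => u2 a - v + e - (if a = b then k * e else 0) with hp
    have hpsum : ∑ a, p a = 0 := by
      simp only [hp, Finset.sum_sub_distrib, Finset.sum_add_distrib, Finset.sum_const,
        Finset.card_univ, nsmul_eq_mul, Finset.sum_ite_eq', Finset.mem_univ, if_true]
      rw [← hk]; linarith
    have hpb : p b = u2 b - v + e - k * e := by simp [hp]
    have hchoice : σ2 p = b := by
      by_contra hne
      have h1 := hσ2opt p hpsum b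
      have h2 : p (σ2 p) = u2 (σ2 p) - v + e := by
        have : p (σ2 p) = u2 (σ2 p) - v + e - (if σ2 p = b then k * e else 0) := rfl
        rw [this, if_neg hne, sub_zero]
      rw [h2, hpb] at h1
      have := mul_pos hkpos hepos
      linarith
    have h3 := hσ1opt p hpsum
    rw [hchoice] at h3
    have h4 : β (σ1 b) < β (p b) := hβ (by rw [hpb]; linarith)
    linarith
  have hnn : ∀ a ∈ (Finset.univ : Finset A), 0 ≤ v - (u2 a - σ1 a) := fun a _ => by
    linarith [hmax a]
  have hsum : ∑ a, (v - (u2 a - σ1 a)) = 0 := by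
    simp only [Finset.sum_sub_distrib, Finset.sum_const, Finset.card_univ, nsmul_eq_mul]
    rw [← hk]; linarith
  intro a
  have := (Finset.sum_eq_zero_iff_of_nonneg hnn).1 hsum a (Finset.mem_univ a)
  linarith
end

section
/- Assume k ≥ 2, let a* be the unique efficient option, and suppose ε > 0 satisfies u1(a) + u2(a) + ((k−1)/k)·ε < u1(a*) + u2(a*) − 2ε for every a ≠ a*. Define p*(a) = u2(a) − Avg2 for a ∈ A, and q* by q*(a*) = p*(a*) − ε and q*(a) = p*(a) + ε/(k−1) for a ≠ a*. Then β2^ε(q*) = {a*}, and for any σ2 : P → A such that σ2(p) minimizes a ↦ g1(p,a) over β2^ε(p) for every p ∈ P, the profile (q*, σ2) is an ε-robust subgame-perfect Nash equilibrium with outcome σ2(q*) = a*. -/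
open Finset

/-- `a` is an ε-maximizer for player 2 at the price vector `p`
(i.e. `a ∈ β2^ε(p)`): no option is better for player 2 by more than `ε`. -/
def epsBest2 {A : Type*} (u2 : A → ℝ) (ε : ℝ) (p : A → ℝ) (a : A) : Prop :=
  ∀ a' : A, u2 a' - p a' ≤ u2 a - p a + ε

/-- ε-robust subgame-perfect Nash equilibrium of the Price & Choose game:
`σ1 ∈ P`; for every `p ∈ P`, `σ2 p` minimizes player 1's payoff `a ↦ u1 a + p a`
over the ε-maximizers `β2^ε(p)` of player 2; and player 1 is ε-maximizing when
choosing `σ1` within `P`. -/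
def epsRobustSPNE {A : Type*} [Fintype A] (u1 u2 : A → ℝ) (ε : ℝ)
    (σ1 : A → ℝ) (σ2 : (A → ℝ) → A) : Prop :=
  (∑ a, σ1 a = 0) ∧
  (∀ p : A → ℝ, (∑ a, p a = 0) →
    epsBest2 u2 ε p (σ2 p) ∧
      ∀ a : A, epsBest2 u2 ε p a → u1 (σ2 p) + p (σ2 p) ≤ u1 a + p a) ∧
  (∀ p : A → ℝ, (∑ a, p a = 0) →
    u1 (σ2 p) + p (σ2 p) ≤ u1 (σ2 σ1) + σ1 (σ2 σ1) + ε)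

/-- with `k ≥ 2`, `a*` the unique efficient option, and `ε > 0` small
enough that `u1 a + u2 a + ((k−1)/k)·ε < u1 a* + u2 a* − 2ε` for all `a ≠ a*`, the
price vector `q*` (with `q* a* = p* a* − ε` and `q* a = p* a + ε/(k−1)` otherwise,
where `p* a = u2 a − Avg2`) has `β2^ε(q*) = {a*}`; and for any adversarial `σ2`,
the profile `(q*, σ2)` is an ε-robust SPNE with outcome `a*`. -/
theorem pc_eps_robust_equilibrium_exists
    {A : Type*} [Fintype A] [DecidableEq A] [Nonempty A] (u1 u2 : A → ℝ)
    (hk : 2 ≤ Fintype.card A)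
    (ε : ℝ) (hε : 0 < ε)
    (astar : A)
    (hstar : ∀ a : A, a ≠ astar → u1 a + u2 a < u1 astar + u2 astar)
    (hεsmall : ∀ a : A, a ≠ astar →
      u1 a + u2 a + (((Fintype.card A : ℝ) - 1) / (Fintype.card A : ℝ)) * ε
        < u1 astar + u2 astar - 2 * ε)
    (σ2 : (A → ℝ) → A)
    (hσ2 : ∀ p : A → ℝ, (∑ a, p a = 0) →
      epsBest2 u2 ε p (σ2 p) ∧
        ∀ a : A, epsBest2 u2 ε p a → u1 (σ2 p) + p (σ2 p) ≤ u1 a + p a) :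
    let pstar : A → ℝ := fun a => u2 a - (∑ x, u2 x) / (Fintype.card A : ℝ)
    let qstar : A → ℝ := fun a =>
      if a = astar then pstar astar - ε
      else pstar a + ε / ((Fintype.card A : ℝ) - 1)
    (∀ a : A, epsBest2 u2 ε qstar a ↔ a = astar) ∧
    epsRobustSPNE u1 u2 ε qstar σ2 ∧
    σ2 qstar = astar := by
  intro pstar qstar
  have hk2 : (2 : ℝ) ≤ (Fintype.card A : ℝ) := by exact_mod_cast hk
  have hd : 0 < ε / ((Fintype.card A : ℝ) - 1) := div_pos hε (by linarith)
  have hqs : qstar astar = u2 astar - (∑ x, u2 x) / (Fintype.card A : ℝ) - ε := by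
    simp [qstar, pstar]
  have hqn : ∀ a, a ≠ astar → qstar a = u2 a - (∑ x, u2 x) / (Fintype.card A : ℝ)
      + ε / ((Fintype.card A : ℝ) - 1) := by
    intro a ha
    simp [qstar, pstar, ha]
  have hbest : ∀ a : A, epsBest2 u2 ε qstar a ↔ a = astar := by
    intro a
    constructor
    · intro h
      by_contra hne
      have h1 := h astar
      rw [hqs, hqn a hne] at h1
      linarith
    · rintro rfl a'
      by_cases h : a' = a
      · subst h
        linarith
      · rw [hqs, hqn a' h]
        linarith
  have hsum : ∑ a, qstar a = 0 := by
    have h1 : ∀ a, qstar a = u2 a + (ε / ((Fintype.card A : ℝ) - 1)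
        - (∑ x, u2 x) / (Fintype.card A : ℝ))
        + (if a = astar then - ε - ε / ((Fintype.card A : ℝ) - 1) else 0) := by
      intro a
      by_cases h : a = astar
      · subst h
        rw [hqs, if_pos rfl]
        ring
      · rw [hqn a h, if_neg h]
        ring
    rw [Finset.sum_congr rfl (fun a _ => h1 a), Finset.sum_add_distrib, Finset.sum_add_distrib,
      Finset.sum_ite_eq' Finset.univ astar]
    simp only [Finset.sum_const, Finset.card_univ, nsmul_eq_mul, Finset.mem_univ, if_true]
    have h2 : (Fintype.card A : ℝ) - 1 ≠ 0 := by linarith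
    have h3 : (Fintype.card A : ℝ) ≠ 0 := by linarith
    field_simp
    ring
  have hout : σ2 qstar = astar := (hbest _).1 (hσ2 qstar hsum).1
  refine ⟨hbest, ⟨hsum, hσ2, ?_⟩, hout⟩
  intro p hp
  rw [hout, hqs]
  obtain ⟨b, hb⟩ := Finite.exists_max (fun a => u2 a - p a)
  have hbb : epsBest2 u2 ε p b := fun a' => by
    have := hb a'
    linarith
  have h1 := (hσ2 p hp).2 b hbb
  have h2 : (∑ x, u2 x) / (Fintype.card A : ℝ) ≤ u2 b - p b := by
    rw [div_le_iff₀ (by linarith)]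
    have h3 : ∑ a, (u2 a - p a) ≤ ∑ _a : A, (u2 b - p b) :=
      Finset.sum_le_sum (fun a _ => hb a)
    rw [Finset.sum_sub_distrib, hp, Finset.sum_const, Finset.card_univ, nsmul_eq_mul] at h3
    linarith
  have h4 : u1 b + u2 b ≤ u1 astar + u2 astar := by
    by_cases h : b = astar
    · rw [h]
    · exact (hstar b h).le
  linarith
end

section
/- Assume k ≥ 2, let a* be the unique efficient option, and suppose ε > 0 satisfies u1(a) + u2(a) + ((k−1)/k)·ε < u1(a*) + u2(a*) − 2ε for every a ≠ a*. Then every ε-robust subgame-perfect Nash equilibrium (σ1, σ2) of the Price & Choose game has outcome σ2(σ1) = a*. -/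
open Finset

/-- with `k ≥ 2`, `a*` the unique efficient option, and `ε > 0` small
enough that `u1 a + u2 a + ((k−1)/k)·ε < u1 a* + u2 a* − 2ε` for all `a ≠ a*`, every
ε-robust subgame-perfect Nash equilibrium of the Price & Choose game has outcome `a*`. -/
theorem pc_eps_robust_outcome_unique
    {A : Type*} [Fintype A] [Nonempty A] (u1 u2 : A → ℝ)
    (hk : 2 ≤ Fintype.card A)
    (ε : ℝ) (hε : 0 < ε)
    (astar : A)
    (hstar : ∀ a : A, a ≠ astar → u1 a + u2 a < u1 astar + u2 astar)
    (hεsmall : ∀ a : A, a ≠ astar →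
      u1 a + u2 a + (((Fintype.card A : ℝ) - 1) / (Fintype.card A : ℝ)) * ε
        < u1 astar + u2 astar - 2 * ε)
    (σ1 : A → ℝ) (σ2 : (A → ℝ) → A)
    (hspne : epsRobustSPNE u1 u2 ε σ1 σ2) :
    σ2 σ1 = astar := by
  classical
  obtain ⟨h0, h1, h2⟩ := hspne
  by_contra hne
  have hG := hεsmall _ hne
  have hb := (h1 σ1 h0).1
  set a := σ2 σ1 with ha
  set k : ℝ := (Fintype.card A : ℝ) with hkdef
  have hk2 : (2 : ℝ) ≤ k := by rw [hkdef]; exact_mod_cast hk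
  have hkpos : 0 < k := by linarith
  set c : ℝ := (k - 1) / k with hc
  have hc1 : c < 1 := by rw [hc, div_lt_one hkpos]; linarith
  have hkc : k * c = k - 1 := by rw [hc]; field_simp
  obtain ⟨δ, hδ⟩ : ∃ δ, δ = u1 astar + u2 astar - 2 * ε - (u1 a + u2 a + c * ε) := ⟨_, rfl⟩
  have hδpos : 0 < δ := by linarith
  obtain ⟨m, hm⟩ : ∃ m, m = (∑ x, u2 x) / k := ⟨_, rfl⟩
  have hkm : k * m = ∑ x, u2 x := by rw [hm]; field_simp
  -- player 2's equilibrium payoff is at least the average minus ε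
  have hM : m ≤ u2 a - σ1 a + ε := by
    have hs : ∑ x, (u2 x - σ1 x) ≤ ∑ _x : A, (u2 a - σ1 a + ε) :=
      Finset.sum_le_sum fun x _ => hb x
    rw [Finset.sum_sub_distrib, h0, Finset.sum_const, Finset.card_univ, nsmul_eq_mul,
      ← hkdef, ← hkm, sub_zero] at hs
    exact le_of_mul_le_mul_left hs hkpos
  -- player 1's deviation
  obtain ⟨p, hp⟩ : ∃ p : A → ℝ, p = fun x =>
      u2 x - (m + c * (ε + δ)) + ((ε + δ) - if x = astar then ε + δ else 0) := ⟨_, rfl⟩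
  have hp0 : ∑ x, p x = 0 := by
    rw [hp]
    simp only [Finset.sum_add_distrib, Finset.sum_sub_distrib, Finset.sum_const,
      Finset.card_univ, nsmul_eq_mul, Finset.sum_ite_eq', Finset.mem_univ, if_true]
    rw [← hkdef, ← hkm]
    linear_combination (-(ε + δ)) * hkc
  have hps : p astar = u2 astar - (m + c * (ε + δ)) := by rw [hp]; simp
  have hσ : σ2 p = astar := by
    by_contra hn
    have h := (h1 p hp0).1 astar
    have hpn : p (σ2 p) = u2 (σ2 p) - (m + c * (ε + δ)) + (ε + δ) := by
      generalize σ2 p = b at hn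
      rw [hp]; simp [hn]
    rw [hps, hpn] at h
    linarith
  have h3 := h2 p hp0
  rw [hσ, hps] at h3
  have : c * δ < 1 * δ := mul_lt_mul_of_pos_right hc1 hδpos
  linarith
end

section
/- In the bidding game preceding Price & Choose, the symmetric bid profile in which every player bids b* = ((n−1)/n)·η is a Nash equilibrium, and at this profile every player i's expected payoff equals Avg_i + η/n. -/
open Finset

/-- `η = max(u) − ∑_i Avg_i` for the bidding game preceding Price & Choose. -/
noncomputable def bidEta {A : Type*} [Fintype A] [Nonempty A] (n : ℕ)
    (u : Fin n → A → ℝ) : ℝ :=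
  (Finset.univ.sup' Finset.univ_nonempty fun a : A => ∑ j, u j a)
    - ∑ j, (∑ a, u j a) / (Fintype.card A : ℝ)

/-- Expected payoff of player `i` in the bidding game preceding Price & Choose,
at the bid profile `b`: with `M = max_j b_j` and `W = {j : b_j = M}`,
`π_i(b) = Avg_i + (1/|W|)(η − M) + ((|W|−1)/|W|)·M/(n−1)` if `i ∈ W`, and
`π_i(b) = Avg_i + M/(n−1)` otherwise. -/
noncomputable def bidPayoff {A : Type*} [Fintype A] [Nonempty A] (n : ℕ) (hn : 2 ≤ n)
    (u : Fin n → A → ℝ) (b : Fin n → ℝ) (i : Fin n) : ℝ :=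
  haveI : Nonempty (Fin n) := Fin.pos_iff_nonempty.mp (by omega)
  let Avg : Fin n → ℝ := fun j => (∑ a, u j a) / (Fintype.card A : ℝ)
  let M : ℝ := Finset.univ.sup' Finset.univ_nonempty b
  let W : Finset (Fin n) := Finset.univ.filter (fun j => b j = M)
  if i ∈ W then
    Avg i + (1 / (W.card : ℝ)) * (bidEta n u - M)
      + (((W.card : ℝ) - 1) / (W.card : ℝ)) * (M / ((n : ℝ) - 1))
  else Avg i + M / ((n : ℝ) - 1)

/-- Nash equilibrium of the bidding game: all bids are nonnegative and no player can
strictly increase her expected payoff by unilaterally changing her bid within `[0, ∞)`. -/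
def bidNE {A : Type*} [Fintype A] [Nonempty A] (n : ℕ) (hn : 2 ≤ n)
    (u : Fin n → A → ℝ) (b : Fin n → ℝ) : Prop :=
  (∀ i, 0 ≤ b i) ∧
  ∀ (i : Fin n) (c : ℝ), 0 ≤ c →
    bidPayoff n hn u (Function.update b i c) i ≤ bidPayoff n hn u b i

theorem bidEta_nonneg' {A : Type*} [Fintype A] [Nonempty A] (n : ℕ)
    (u : Fin n → A → ℝ) : 0 ≤ bidEta n u := by
  unfold bidEta
  have hc : (0 : ℝ) < (Fintype.card A : ℝ) := by exact_mod_cast Fintype.card_pos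
  rw [sub_nonneg, ← Finset.sum_div, div_le_iff₀ hc, Finset.sum_comm]
  have h := Finset.sum_le_card_nsmul (Finset.univ : Finset A) (fun a => ∑ j, u j a)
    (Finset.univ.sup' Finset.univ_nonempty fun a : A => ∑ j, u j a)
    (fun a ha => Finset.le_sup' (fun a : A => ∑ j, u j a) ha)
  rw [nsmul_eq_mul, Finset.card_univ, mul_comm] at h
  exact h

/-- If the highest bid is `b*`, every player gets `Avg_i + η/n`. -/
theorem bidPayoff_of_max {A : Type*} [Fintype A] [Nonempty A] (n : ℕ) (hn : 2 ≤ n)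
    (u : Fin n → A → ℝ) (b : Fin n → ℝ) (i : Fin n)
    (hle : ∀ j, b j ≤ (((n : ℝ) - 1) / (n : ℝ)) * bidEta n u)
    (hex : ∃ j, b j = (((n : ℝ) - 1) / (n : ℝ)) * bidEta n u) :
    bidPayoff n hn u b i =
      (∑ a, u i a) / (Fintype.card A : ℝ) + bidEta n u / (n : ℝ) := by
  have hn' : (2 : ℝ) ≤ n := by exact_mod_cast hn
  have hn0 : (n : ℝ) ≠ 0 := by linarith
  have hn1 : (n : ℝ) - 1 ≠ 0 := by linarith
  haveI : Nonempty (Fin n) := ⟨i⟩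
  have hM : Finset.univ.sup' Finset.univ_nonempty b
      = (((n : ℝ) - 1) / (n : ℝ)) * bidEta n u := by
    apply le_antisymm
    · exact Finset.sup'_le _ _ (fun j _ => hle j)
    · obtain ⟨j, hj⟩ := hex
      rw [← hj]
      exact Finset.le_sup' b (Finset.mem_univ j)
  have h1 : bidEta n u - (((n : ℝ) - 1) / (n : ℝ)) * bidEta n u = bidEta n u / n := by
    field_simp
    ring
  have h2 : (((n : ℝ) - 1) / (n : ℝ)) * bidEta n u / ((n : ℝ) - 1) = bidEta n u / n := by
    field_simp
  unfold bidPayoff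
  simp only [hM, h1, h2]
  split_ifs with hW
  · have hc := Finset.card_pos.mpr ⟨i, hW⟩
    generalize (Finset.univ.filter
      (fun j => b j = (((n : ℝ) - 1) / (n : ℝ)) * bidEta n u)).card = w at hc ⊢
    have hw : (w : ℝ) ≠ 0 := by exact_mod_cast hc.ne'
    rw [add_assoc, ← add_mul, ← add_div, add_sub_cancel, div_self hw, one_mul]
  · rfl

/-- A strict sole winner `i` gets `Avg_i + η - b_i`. -/
theorem bidPayoff_of_sole {A : Type*} [Fintype A] [Nonempty A] (n : ℕ) (hn : 2 ≤ n)
    (u : Fin n → A → ℝ) (b : Fin n → ℝ) (i : Fin n)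
    (hlt : ∀ j, j ≠ i → b j < b i) :
    bidPayoff n hn u b i =
      (∑ a, u i a) / (Fintype.card A : ℝ) + (bidEta n u - b i) := by
  haveI : Nonempty (Fin n) := ⟨i⟩
  have hM : Finset.univ.sup' Finset.univ_nonempty b = b i := by
    apply le_antisymm
    · refine Finset.sup'_le _ _ (fun j _ => ?_)
      by_cases h : j = i
      · rw [h]
      · exact (hlt j h).le
    · exact Finset.le_sup' b (Finset.mem_univ i)
  have hW : Finset.univ.filter (fun j => b j = b i) = {i} := by
    ext j
    simp only [Finset.mem_filter, Finset.mem_univ, true_and, Finset.mem_singleton]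
    constructor
    · intro h
      by_contra hne
      exact (hlt j hne).ne h
    · rintro rfl
      rfl
  unfold bidPayoff
  simp only [hM, hW]
  simp

/-- the symmetric profile in which every player bids
`b* = ((n−1)/n)·η` is a Nash equilibrium of the bidding game, and at this profile
every player `i`'s expected payoff equals `Avg_i + η/n`. -/
theorem bid_symmetric_equilibrium
    {A : Type*} [Fintype A] [Nonempty A] (n : ℕ) (hn : 2 ≤ n)
    (u : Fin n → A → ℝ) :
    bidNE n hn u (fun _ => (((n : ℝ) - 1) / (n : ℝ)) * bidEta n u) ∧
    ∀ i : Fin n,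
      bidPayoff n hn u (fun _ => (((n : ℝ) - 1) / (n : ℝ)) * bidEta n u) i =
        (∑ a, u i a) / (Fintype.card A : ℝ) + bidEta n u / (n : ℝ) := by
  have hsym : ∀ i : Fin n,
      bidPayoff n hn u (fun _ => (((n : ℝ) - 1) / (n : ℝ)) * bidEta n u) i =
        (∑ a, u i a) / (Fintype.card A : ℝ) + bidEta n u / (n : ℝ) := fun i =>
    bidPayoff_of_max n hn u _ i (fun _ => le_rfl) ⟨i, rfl⟩
  have hn' : (2 : ℝ) ≤ n := by exact_mod_cast hn
  have hn0 : (n : ℝ) ≠ 0 := by linarith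
  refine ⟨⟨fun _ => ?_, fun i c _ => ?_⟩, hsym⟩
  · exact mul_nonneg (div_nonneg (by linarith) (by linarith)) (bidEta_nonneg' n u)
  · rw [hsym i]
    rcases le_or_gt c ((((n : ℝ) - 1) / (n : ℝ)) * bidEta n u) with hc | hc
    · apply le_of_eq
      apply bidPayoff_of_max
      · intro j
        by_cases h : j = i
        · subst h
          simpa using hc
        · simp [Function.update_of_ne h]
      · haveI : Nontrivial (Fin n) := Fin.nontrivial_iff_two_le.mpr hn
        obtain ⟨j, hj⟩ := exists_ne i
        exact ⟨j, by simp [Function.update_of_ne hj]⟩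
    · rw [bidPayoff_of_sole]
      · rw [Function.update_self]
        have h1 : bidEta n u - (((n : ℝ) - 1) / (n : ℝ)) * bidEta n u = bidEta n u / n := by
          field_simp
          ring
        linarith
      · intro j hj
        rw [Function.update_self, Function.update_of_ne hj]
        exact hc
end

section
/- The bidding game preceding Price & Choose has no Nash equilibrium in which the set of winners is a singleton: if exactly one player submits the strictly highest bid, that player has a profitable unilateral deviation (lowering her bid while still winning). -/
open Finset

/-- Payoff of a sole strict highest bidder. -/
theorem bidPayoff_sole {A : Type*} [Fintype A] [Nonempty A] (n : ℕ) (hn : 2 ≤ n)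
    (u : Fin n → A → ℝ) (b : Fin n → ℝ) (i : Fin n) (hi : ∀ j : Fin n, j ≠ i → b j < b i) :
    bidPayoff n hn u b i = (∑ a, u i a) / (Fintype.card A : ℝ) + (bidEta n u - b i) := by
  haveI : Nonempty (Fin n) := ⟨i⟩
  have hM : Finset.univ.sup' Finset.univ_nonempty b = b i := by
    apply le_antisymm
    · apply Finset.sup'_le
      intro j _
      by_cases h : j = i
      · rw [h]
      · exact (hi j h).le
    · exact Finset.le_sup' b (Finset.mem_univ i)
  have hW : Finset.univ.filter (fun j => b j = b i) = {i} := by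
    ext j
    simp only [Finset.mem_filter, Finset.mem_univ, true_and, Finset.mem_singleton]
    constructor
    · intro h
      by_contra hne
      exact (hi j hne).ne h
    · intro h
      rw [h]
  simp [bidPayoff, hM, hW]

/-- the bidding game has no Nash equilibrium with a singleton set of
winners: if exactly one player `i` submits the strictly highest bid, then `i` has a
profitable unilateral deviation lowering her bid while still winning; in particular,
`b` is not a Nash equilibrium. -/
theorem bid_no_singleton_winner_equilibrium
    {A : Type*} [Fintype A] [Nonempty A] (n : ℕ) (hn : 2 ≤ n)
    (u : Fin n → A → ℝ) (b : Fin n → ℝ) (hb : ∀ j, 0 ≤ b j)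
    (i : Fin n) (hi : ∀ j : Fin n, j ≠ i → b j < b i) :
    (∃ c : ℝ, 0 ≤ c ∧ c < b i ∧
      bidPayoff n hn u b i < bidPayoff n hn u (Function.update b i c) i) ∧
    ¬ bidNE n hn u b := by
  have key : ∃ c : ℝ, 0 ≤ c ∧ c < b i ∧
      bidPayoff n hn u b i < bidPayoff n hn u (Function.update b i c) i := by
    obtain ⟨k, hk⟩ : ∃ k : Fin n, k ≠ i := by
      haveI : Nontrivial (Fin n) := Fin.nontrivial_iff_two_le.mpr hn
      exact exists_ne i
    have hne : (Finset.univ.erase i).Nonempty := ⟨k, by simp [hk]⟩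
    obtain ⟨m, hm, hmax⟩ := Finset.exists_max_image (Finset.univ.erase i) b hne
    have hmi : b m < b i := hi m (Finset.ne_of_mem_erase hm)
    have hm0 := hb m
    refine ⟨(b m + b i) / 2, by linarith, by linarith, ?_⟩
    rw [bidPayoff_sole n hn u b i hi, bidPayoff_sole n hn u (Function.update b i _) i]
    · rw [Function.update_self]
      linarith
    · intro j hj
      rw [Function.update_self, Function.update_of_ne hj]
      have := hmax j (by simp [hj])
      linarith
  refine ⟨key, fun h => ?_⟩
  obtain ⟨c, hc, _, hlt⟩ := key
  exact absurd (h.2 i c hc) (not_le.mpr hlt)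
end
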